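/- There exists a function W : ℂ → ℂ which is entire, whose restriction to ℝ is a real-valued, even, nonnegative Schwartz function, and such that: (i) the Fourier transform Ŵ(u) = ∫_ℝ W(x)·e^{−2πiux} dx satisfies Ŵ(0) = 1; (ii) Ŵ is supported in [−1, 1]; (iii) Ŵ is (weakly) decreasing on [0, 1]; and (iv) there is a constant C > 0 with W(x) ≤ C·exp(−|x| / (log(2 + |x|))²) for all real x. -/

import Mathlib

open MeasureTheory

namespace Ingham

open Real Filter Topology Set FourierTransform ContDiff

/-- The cosine transform of a real function; for even functions it is the Fourier transform. -/
noncomputable def cosTransform (f : ℝ → ℝ) (u : ℝ) : ℝ := ∫ x, f x * cos (2 * π * u * x)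

lemma integrable_mul_cos {f : ℝ → ℝ} (hf : Integrable f) (c : ℝ) :
    Integrable fun x => f x * cos (c * x) :=
  hf.mul_bdd (c := 1) (by fun_prop) (ae_of_all _ fun x => abs_cos_le_one _)

lemma integrable_mul_sin {f : ℝ → ℝ} (hf : Integrable f) (c : ℝ) :
    Integrable fun x => f x * sin (c * x) :=
  hf.mul_bdd (c := 1) (by fun_prop) (ae_of_all _ fun x => abs_sin_le_one _)

lemma cosTransform_neg (f : ℝ → ℝ) (u : ℝ) : cosTransform f (-u) = cosTransform f u := by
  simp [cosTransform]

lemma integral_mul_sin_eq_zero {f : ℝ → ℝ} (he : ∀ x, f (-x) = f x) (c : ℝ) :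
    ∫ x, f x * sin (c * x) = 0 := by
  have h := integral_neg_eq_self (fun x => f x * sin (c * x)) volume
  simp only [he, mul_neg, sin_neg, integral_neg] at h
  linarith

lemma integral_mul_cexp {f : ℝ → ℝ} (hf : Integrable f) (he : ∀ x, f (-x) = f x) (u : ℝ) :
    ∫ x : ℝ, (f x : ℂ) * Complex.exp (-(2 * π * u * x) * Complex.I) = cosTransform f u := by
  have h1 : ∀ x : ℝ, (f x : ℂ) * Complex.exp (-(2 * π * u * x) * Complex.I)
      = ((f x * cos (2 * π * u * x) : ℝ) : ℂ)
        - ((f x * sin (2 * π * u * x) : ℝ) : ℂ) * Complex.I := by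
    intro x
    have : (-(2 * π * u * x) : ℂ) = ((-(2 * π * u * x) : ℝ) : ℂ) := by push_cast; ring
    rw [this, Complex.exp_mul_I, ← Complex.ofReal_cos, ← Complex.ofReal_sin, cos_neg, sin_neg]
    push_cast
    ring
  simp_rw [h1]
  rw [integral_sub (integrable_mul_cos hf _).ofReal
    ((integrable_mul_sin hf _).ofReal.mul_const _), integral_mul_const, integral_complex_ofReal,
    integral_complex_ofReal, integral_mul_sin_eq_zero he]
  simp [cosTransform]

lemma fourier_eq_cosTransform {f : ℝ → ℝ} (hf : Integrable f) (he : ∀ x, f (-x) = f x) (u : ℝ) :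
    𝓕 (fun x => (f x : ℂ)) u = cosTransform f u := by
  rw [← integral_mul_cexp hf he, fourier_real_eq_integral_exp_smul]
  congr 1 with x
  rw [smul_eq_mul, mul_comm]
  congr 2
  push_cast
  ring

lemma cosTransform_cosTransform {f : ℝ → ℝ} (hc : Continuous f) (hf : Integrable f)
    (he : ∀ x, f (-x) = f x) (hF : Integrable (cosTransform f)) (x : ℝ) :
    cosTransform (cosTransform f) x = f x := by
  have h1 : 𝓕 (fun x => (f x : ℂ)) = fun u => (cosTransform f u : ℂ) :=
    funext (fourier_eq_cosTransform hf he)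
  have h2 := congrFun (Continuous.fourierInv_fourier_eq (f := fun x => (f x : ℂ))
    (by fun_prop) hf.ofReal (by rw [h1]; exact hF.ofReal)) x
  rw [h1, fourierInv_eq_fourier_neg, fourier_eq_cosTransform hF (cosTransform_neg f),
    cosTransform_neg] at h2
  exact_mod_cast h2

/-- Even continuous functions supported in `[-L, L]` that decrease on `[0, ∞)`. -/
structure IsUnimodal (F : ℝ → ℝ) (L : ℝ) : Prop where
  continuous : Continuous F
  even : ∀ u, F (-u) = F u
  eq_zero : ∀ u, L ≤ u → F u = 0
  antitone : ∀ u v, 0 ≤ u → u ≤ v → F v ≤ F u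

namespace IsUnimodal

variable {F : ℝ → ℝ} {L : ℝ}

lemma eq_zero_of_le_abs (h : IsUnimodal F L) {u : ℝ} (hu : L ≤ |u|) : F u = 0 := by
  rcases abs_cases u with ⟨h1, -⟩ | ⟨h1, -⟩
  · exact h.eq_zero u (h1 ▸ hu)
  · rw [← h.even]; exact h.eq_zero (-u) (h1 ▸ hu)

lemma hasCompactSupport (h : IsUnimodal F L) : HasCompactSupport F :=
  HasCompactSupport.intro (isCompact_Icc (a := -L) (b := L)) fun u hu =>
    h.eq_zero_of_le_abs <| by
      by_contra! hlt
      exact hu ⟨(abs_lt.1 hlt).1.le, (abs_lt.1 hlt).2.le⟩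

lemma integrable (h : IsUnimodal F L) : Integrable F :=
  h.continuous.integrable_of_hasCompactSupport h.hasCompactSupport

lemma mono {M : ℝ} (h : IsUnimodal F L) (hLM : L ≤ M) : IsUnimodal F M :=
  ⟨h.continuous, h.even, fun u hu => h.eq_zero u (hLM.trans hu), h.antitone⟩

lemma le_of_abs_le (h : IsUnimodal F L) {u v : ℝ} (huv : |u| ≤ |v|) : F v ≤ F u := by
  have habs : ∀ w, F |w| = F w := fun w => by
    rcases abs_choice w with h1 | h1 <;> rw [h1]
    exact h.even w
  rw [← habs u, ← habs v]
  exact h.antitone _ _ (abs_nonneg u) huv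

/-- Averaging over a centred interval of half-length `a`. -/
lemma average (h : IsUnimodal F L) {a : ℝ} (ha : 0 < a) :
    IsUnimodal (fun u => 1 / 2 * ∫ s in (-1 : ℝ)..1, F (u + a * s)) (L + a) where
  continuous := by
    have := h.continuous
    apply continuous_const.mul
    apply intervalIntegral.continuous_parametric_intervalIntegral_of_continuous'
    fun_prop
  even u := by
    congr 1
    have := intervalIntegral.integral_comp_neg (a := -1) (b := 1) (fun s => F (u + a * s))
    rw [neg_neg] at this
    rw [← this]
    congr 1 with s
    rw [← h.even]
    congr 1
    ring
  eq_zero u hu := by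
    rw [mul_eq_zero]
    right
    rw [intervalIntegral.integral_congr (g := fun _ => 0)]
    · simp
    intro s hs
    rw [uIcc_of_le (by norm_num)] at hs
    apply h.eq_zero
    nlinarith [hs.1]
  antitone u v hu huv := by
    have hi : ∀ p q : ℝ, IntervalIntegrable F volume p q := fun p q =>
      h.continuous.intervalIntegrable p q
    simp only [intervalIntegral.integral_comp_add_mul _ ha.ne', smul_eq_mul, mul_neg, mul_one]
    have key : 0 ≤ (∫ x in u + -a..u + a, F x) - ∫ x in v + -a..v + a, F x := by
      rw [intervalIntegral.integral_interval_sub_interval_comm (hi _ _) (hi _ _) (hi _ _),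
        ← intervalIntegral.integral_comp_add_right F (-a),
        ← intervalIntegral.integral_comp_add_right F a,
        ← intervalIntegral.integral_sub]
      · apply intervalIntegral.integral_nonneg huv
        intro t ht
        have ht0 := hu.trans ht.1
        refine sub_nonneg.2 (h.le_of_abs_le ?_)
        rw [abs_of_nonneg (add_nonneg ht0 ha.le)]
        exact abs_le.2 ⟨by linarith, by linarith⟩
      all_goals
        have := h.continuous
        apply Continuous.intervalIntegrable
        fun_prop
    have : 0 ≤ a⁻¹ := by positivity
    nlinarith [mul_nonneg this key]

end IsUnimodal

lemma cos_mul_sinc (y b : ℝ) :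
    cos y * sinc b = 1 / 2 * ∫ s in (-1 : ℝ)..1, cos (y + b * s) := by
  rcases eq_or_ne b 0 with rfl | hb
  · simp; ring
  · rw [intervalIntegral.integral_comp_add_mul _ hb, integral_cos, sinc_of_ne_zero hb,
      mul_one, mul_neg, mul_one, sin_add, sin_add, sin_neg, cos_neg, smul_eq_mul]
    field_simp
    ring

lemma cosTransform_mul_sinc {f : ℝ → ℝ} (hf : Integrable f) (a u : ℝ) :
    cosTransform (fun x => f x * sinc (2 * π * a * x)) u
      = 1 / 2 * ∫ s in (-1 : ℝ)..1, cosTransform f (u + a * s) := by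
  have h1 : ∀ x, f x * sinc (2 * π * a * x) * cos (2 * π * u * x)
      = 1 / 2 * ∫ s in (-1 : ℝ)..1, f x * cos (2 * π * (u + a * s) * x) := by
    intro x
    rw [mul_assoc, mul_comm (sinc _), cos_mul_sinc, intervalIntegral.integral_const_mul,
      mul_left_comm]
    congr 3
    congr 1 with s
    congr 1
    ring
  simp only [cosTransform, h1]
  rw [integral_const_mul, intervalIntegral_integral_swap]
  have h2 : Integrable (fun p : ℝ × ℝ => (1 : ℝ) * f p.2)
      ((volume.restrict (uIoc (-1 : ℝ) 1)).prod volume) :=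
    Integrable.mul_prod (f := fun _ : ℝ => (1 : ℝ)) (by
      rw [uIoc_of_le (by norm_num)]
      exact integrable_const _) hf
  have h3 := h2.mul_bdd (c := 1) (g := fun p : ℝ × ℝ => cos (2 * π * (u + a * p.1) * p.2))
    (by fun_prop) (ae_of_all _ fun x => abs_cos_le_one _)
  simpa [Function.uncurry_def] using h3

/-- The triangle function `t ↦ max (1 - 2|t|) 0`. -/
noncomputable def triangle (t : ℝ) : ℝ := max (1 - 2 * |t|) 0

lemma isUnimodal_triangle : IsUnimodal triangle (1 / 2) where
  continuous := by unfold triangle; fun_prop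
  even u := by simp [triangle]
  eq_zero u hu := max_eq_right (by linarith [le_abs_self u])
  antitone u v hu huv := by
    unfold triangle
    rw [abs_of_nonneg hu, abs_of_nonneg (hu.trans huv)]
    gcongr

/-- The Fejér kernel, the Fourier transform of the triangle function. -/
noncomputable def fejer (x : ℝ) : ℝ := 1 / 2 * sinc (π * x / 2) ^ 2

lemma integral_one_sub_mul_cos (c : ℝ) :
    ∫ t in (0 : ℝ)..1 / 2, (1 - 2 * t) * cos (2 * c * t) = 1 / 4 * sinc (c / 2) ^ 2 := by
  rcases eq_or_ne c 0 with rfl | hc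
  · have : ∀ t ∈ uIcc (0 : ℝ) (1 / 2), HasDerivAt (fun t : ℝ => t - t ^ 2)
        ((1 - 2 * t) * cos (2 * 0 * t)) t := by
      intro t _
      refine ((hasDerivAt_id' t).sub (hasDerivAt_pow 2 t)).congr_deriv ?_
      simp
    rw [intervalIntegral.integral_eq_sub_of_hasDerivAt this
      (Continuous.intervalIntegrable (by fun_prop) _ _)]
    norm_num
  · have : ∀ t ∈ uIcc (0 : ℝ) (1 / 2), HasDerivAt
        (fun t : ℝ => (1 - 2 * t) * sin (2 * c * t) / (2 * c) - 2 * cos (2 * c * t) / (2 * c) ^ 2)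
        ((1 - 2 * t) * cos (2 * c * t)) t := by
      intro t _
      have h1 : HasDerivAt (fun t : ℝ => 2 * c * t) (2 * c) t := by
        simpa using (hasDerivAt_id t).const_mul (2 * c)
      have h2 : HasDerivAt (fun t : ℝ => 1 - 2 * t) (-2) t := by
        simpa using ((hasDerivAt_id t).const_mul 2).const_sub 1
      refine (((h2.mul h1.sin).div_const (2 * c)).sub
        ((h1.cos.const_mul 2).div_const ((2 * c) ^ 2))).congr_deriv ?_
      field_simp
      ring
    rw [intervalIntegral.integral_eq_sub_of_hasDerivAt this
      (Continuous.intervalIntegrable (by fun_prop) _ _), sinc_of_ne_zero (by positivity),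
      div_pow, sin_sq_eq_half_sub]
    have e1 : 2 * c * (1 / 2) = c := by ring
    have e2 : 2 * (c / 2) = c := by ring
    rw [e1, e2]
    simp
    field_simp
    ring

lemma cosTransform_triangle (x : ℝ) : cosTransform triangle x = fejer x := by
  have h0 : ∀ t, triangle |t| * cos (2 * π * x * |t|) = triangle t * cos (2 * π * x * t) := by
    intro t
    rcases abs_choice t with h | h <;> simp [h, triangle]
  have h1 := integral_comp_abs (f := fun t => triangle t * cos (2 * π * x * t))
  simp only [h0] at h1
  rw [cosTransform, h1, setIntegral_eq_of_subset_of_forall_sdiff_eq_zero measurableSet_Ioi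
    (Ioc_subset_Ioi_self : Ioc (0 : ℝ) (1 / 2) ⊆ Ioi 0),
    ← intervalIntegral.integral_of_le (by norm_num),
    intervalIntegral.integral_congr (g := fun t => (1 - 2 * t) * cos (2 * (π * x) * t)),
    integral_one_sub_mul_cos, fejer]
  · ring
  · intro t ht
    rw [uIcc_of_le (by norm_num)] at ht
    simp only [triangle]
    rw [abs_of_nonneg ht.1, max_eq_left (by linarith [ht.2])]
    ring_nf
  · rintro t ⟨ht0, ht⟩
    have : 1 / 2 ≤ t := by
      by_contra! h
      exact ht ⟨ht0, h.le⟩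
    rw [isUnimodal_triangle.eq_zero t this, zero_mul]

lemma integrable_fejer : Integrable fejer := by
  refine (integrable_inv_one_add_sq.const_mul 1).mono' (by unfold fejer; fun_prop)
    (ae_of_all _ fun x => ?_)
  have hs : sinc (π * x / 2) ^ 2 ≤ 1 := (sq_le_one_iff_abs_le_one _).2 (abs_sinc_le_one _)
  have h2 : (π * x / 2) ^ 2 * sinc (π * x / 2) ^ 2 ≤ 1 := by
    rcases eq_or_ne (π * x / 2) 0 with h | h
    · rw [h]; simp
    · rw [sinc_of_ne_zero h, ← mul_pow, mul_div_cancel₀ _ h]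
      exact sin_sq_le_one _
  rw [norm_of_nonneg (by unfold fejer; positivity), one_mul, fejer, ← one_div,
    le_div_iff₀ (by positivity)]
  have : x ^ 2 ≤ (π * x / 2) ^ 2 := by
    nlinarith [pi_gt_three, sq_nonneg x, mul_nonneg (sq_nonneg x) (sq_nonneg (π - 2))]
  nlinarith [mul_le_mul_of_nonneg_right this (sq_nonneg (sinc (π * x / 2)))]

lemma cosTransform_fejer : cosTransform fejer = triangle := by
  have h : cosTransform triangle = fejer := funext cosTransform_triangle
  funext x
  rw [← h]
  exact cosTransform_cosTransform isUnimodal_triangle.continuous isUnimodal_triangle.integrable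
    isUnimodal_triangle.even (h ▸ integrable_fejer) x

/-- The half-lengths of the averaging intervals, of size about `1 / (k log² k)`. -/
noncomputable def width (k : ℕ) : ℝ := 1 / log (k + 64) - 1 / log (k + 65)

lemma four_lt_log (k : ℕ) : 4 < log (k + 64) := by
  have h1 : log 64 = 6 * log 2 := by
    rw [show (64 : ℝ) = 2 ^ 6 by norm_num, log_pow]
    norm_num
  have h2 : log 64 ≤ log (k + 64) := log_le_log (by norm_num) (by simp)
  linarith [log_two_gt_d9]

lemma log_lt_log_succ (k : ℕ) : log (k + 64) < log (k + 65) :=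
  log_lt_log (by positivity) (by linarith)

lemma width_pos (k : ℕ) : 0 < width k :=
  sub_pos.2 (one_div_lt_one_div_of_lt (by linarith [four_lt_log k]) (log_lt_log_succ k))

lemma sum_width_le (n : ℕ) : ∑ k ∈ Finset.range n, width k ≤ 1 / 4 := by
  have h : ∀ n : ℕ, ∑ k ∈ Finset.range n, width k = 1 / log 64 - 1 / log (n + 64) := by
    intro n
    induction n with
    | zero => simp
    | succ n ih =>
      rw [Finset.sum_range_succ, ih, width]
      push_cast
      ring_nf
  have h64 : 4 < log 64 := by simpa using four_lt_log 0
  have h1 : 1 / log 64 ≤ 1 / 4 := one_div_le_one_div_of_le (by norm_num) h64.le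
  have h2 : 0 < 1 / log (n + 64) := one_div_pos.2 (by linarith [four_lt_log n])
  rw [h]
  linarith

lemma one_div_le_width (k : ℕ) : 1 / ((k + 65) * log (k + 65) ^ 2) ≤ width k := by
  have h4 := four_lt_log k
  have hlt := log_lt_log_succ k
  have hk : (0 : ℝ) < k + 65 := by positivity
  have h1 : 1 / (k + 65 : ℝ) ≤ log (k + 65) - log (k + 64) := by
    rw [← log_div (by positivity) (by positivity)]
    refine le_trans (le_of_eq ?_) (one_sub_inv_le_log_of_pos (by positivity))
    field_simp
    ring
  have h2 : width k = (log (k + 65) - log (k + 64)) / (log (k + 64) * log (k + 65)) := by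
    have h5 : log ((k : ℝ) + 64) ≠ 0 := by linarith
    have h6 : log ((k : ℝ) + 65) ≠ 0 := by linarith
    rw [width]
    field_simp
  rw [h2, ← div_div, sq]
  refine div_le_div₀ (by linarith) h1 (by nlinarith) ?_
  exact mul_le_mul_of_nonneg_right hlt.le (by linarith)

/-- The finite products approximating the weight. -/
noncomputable def partialWeight (n : ℕ) (x : ℝ) : ℝ :=
  fejer x * ∏ k ∈ Finset.range n, sinc (2 * π * width k * x) ^ 2

lemma fejer_nonneg (x : ℝ) : 0 ≤ fejer x := by unfold fejer; positivity

lemma partialWeight_nonneg (n : ℕ) (x : ℝ) : 0 ≤ partialWeight n x :=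
  mul_nonneg (fejer_nonneg x) (Finset.prod_nonneg fun _ _ => sq_nonneg _)

lemma partialWeight_neg (n : ℕ) (x : ℝ) : partialWeight n (-x) = partialWeight n x := by
  simp [partialWeight, fejer, neg_div]

lemma continuous_partialWeight (n : ℕ) : Continuous (partialWeight n) := by
  unfold partialWeight fejer
  fun_prop

lemma partialWeight_succ (n : ℕ) (x : ℝ) : partialWeight (n + 1) x
    = partialWeight n x * sinc (2 * π * width n * x) * sinc (2 * π * width n * x) := by
  rw [partialWeight, Finset.prod_range_succ, partialWeight]
  ring

lemma antitone_partialWeight (x : ℝ) : Antitone fun n => partialWeight n x := by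
  refine antitone_nat_of_succ_le fun n => ?_
  rw [partialWeight_succ, mul_assoc, ← sq]
  exact mul_le_of_le_one_right (partialWeight_nonneg n x)
    ((sq_le_one_iff_abs_le_one _).2 (abs_sinc_le_one _))

lemma partialWeight_le_fejer (n : ℕ) (x : ℝ) : partialWeight n x ≤ fejer x := by
  simpa [partialWeight] using antitone_partialWeight x (Nat.zero_le n)

lemma integrable_partialWeight (n : ℕ) : Integrable (partialWeight n) :=
  integrable_fejer.mono' (continuous_partialWeight n).aestronglyMeasurable
    (ae_of_all _ fun x => by
      rw [norm_of_nonneg (partialWeight_nonneg n x)]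
      exact partialWeight_le_fejer n x)

lemma isUnimodal_cosTransform_partialWeight (n : ℕ) :
    IsUnimodal (cosTransform (partialWeight n))
      (1 / 2 + 2 * ∑ k ∈ Finset.range n, width k) := by
  induction n with
  | zero =>
    have : partialWeight 0 = fejer := by ext; simp [partialWeight]
    simpa [this, cosTransform_fejer] using isUnimodal_triangle
  | succ n ih =>
    have h1 : Integrable fun x => partialWeight n x * sinc (2 * π * width n * x) :=
      (integrable_partialWeight n).mul_bdd (c := 1) (by fun_prop)
        (ae_of_all _ fun x => abs_sinc_le_one _)
    have h2 := (ih.average (width_pos n)).average (width_pos n)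
    simp only [← cosTransform_mul_sinc (integrable_partialWeight n)] at h2
    simp only [← cosTransform_mul_sinc h1, ← partialWeight_succ] at h2
    convert h2 using 1
    rw [Finset.sum_range_succ]
    ring

lemma isUnimodal_one (n : ℕ) : IsUnimodal (cosTransform (partialWeight n)) 1 :=
  (isUnimodal_cosTransform_partialWeight n).mono (by linarith [sum_width_le n])

/-- The unnormalized weight. -/
noncomputable def weight (x : ℝ) : ℝ := ⨅ n, partialWeight n x

lemma bddBelow_partialWeight (x : ℝ) : BddBelow (range fun n => partialWeight n x) :=
  ⟨0, by rintro _ ⟨n, rfl⟩; exact partialWeight_nonneg n x⟩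

lemma tendsto_partialWeight (x : ℝ) :
    Tendsto (fun n => partialWeight n x) atTop (𝓝 (weight x)) :=
  tendsto_atTop_ciInf (antitone_partialWeight x) (bddBelow_partialWeight x)

lemma weight_le (n : ℕ) (x : ℝ) : weight x ≤ partialWeight n x :=
  ciInf_le (bddBelow_partialWeight x) n

lemma weight_nonneg (x : ℝ) : 0 ≤ weight x := le_ciInf fun n => partialWeight_nonneg n x

lemma weight_neg (x : ℝ) : weight (-x) = weight x := by simp [weight, partialWeight_neg]

lemma weight_zero : weight 0 = 1 / 2 := by simp [weight, partialWeight, fejer]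

lemma measurable_weight : Measurable weight :=
  measurable_of_tendsto_metrizable (fun n => (continuous_partialWeight n).measurable)
    (tendsto_pi_nhds.2 tendsto_partialWeight)

lemma sinc_sq_le {y : ℝ} (hy : y ≠ 0) : sinc y ^ 2 ≤ 1 / y ^ 2 := by
  rw [sinc_of_ne_zero hy, div_pow]
  gcongr
  exact sin_sq_le_one y

lemma exists_pow_mul_weight_le (n : ℕ) : ∃ C, ∀ x, x ^ (2 * n) * weight x ≤ C * fejer x := by
  refine ⟨∏ k ∈ Finset.range n, 1 / (2 * π * width k) ^ 2, fun x => ?_⟩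
  have h1 : x ^ (2 * n) * weight x ≤ x ^ (2 * n) * partialWeight n x :=
    mul_le_mul_of_nonneg_left (weight_le n x) (by rw [pow_mul]; positivity)
  refine h1.trans ?_
  have h2 : x ^ (2 * n) = ∏ k ∈ Finset.range n, x ^ 2 := by simp [pow_mul]
  rw [partialWeight, mul_left_comm, h2, ← Finset.prod_mul_distrib, mul_comm (fejer x)]
  refine mul_le_mul_of_nonneg_right ?_ (fejer_nonneg x)
  refine Finset.prod_le_prod (fun k _ => by positivity) fun k _ => ?_
  have hw := width_pos k
  rcases eq_or_ne x 0 with rfl | hx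
  · simp; positivity
  · have := sinc_sq_le (y := 2 * π * width k * x) (by positivity)
    refine (mul_le_mul_of_nonneg_left this (sq_nonneg x)).trans (le_of_eq ?_)
    field_simp

lemma integrable_pow_mul_weight (n : ℕ) : Integrable fun x => ‖x‖ ^ n * ‖weight x‖ := by
  obtain ⟨C, hC⟩ := exists_pow_mul_weight_le n
  obtain ⟨D, hD⟩ := exists_pow_mul_weight_le 0
  refine (integrable_fejer.const_mul (C + D)).mono' ?_ (ae_of_all _ fun x => ?_)
  · exact (measurable_norm.pow_const n |>.mul measurable_weight.norm).aestronglyMeasurable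
  · have hw := weight_nonneg x
    rw [norm_of_nonneg (by positivity), norm_of_nonneg hw]
    have h1 : ‖x‖ ^ n ≤ x ^ (2 * n) + x ^ (2 * 0) := by
      rw [mul_zero, pow_zero, pow_mul, ← sq_abs, ← norm_eq_abs, ← pow_mul, mul_comm, pow_mul]
      nlinarith [sq_nonneg (‖x‖ ^ n - 1), sq_nonneg (‖x‖ ^ n)]
    nlinarith [hC x, hD x, mul_le_mul_of_nonneg_right h1 hw]

lemma integrable_weight : Integrable weight := by
  have h := integrable_pow_mul_weight 0
  simp only [pow_zero, one_mul] at h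
  exact (integrable_norm_iff measurable_weight.aestronglyMeasurable).1 h

lemma contDiff_cosTransform_weight : ContDiff ℝ ∞ (cosTransform weight) := by
  have h : ContDiff ℝ ∞ (𝓕 fun x => (weight x : ℂ)) :=
    contDiff_fourier (N := ⊤) fun n _ => by
      simpa using integrable_pow_mul_weight n
  have h2 : cosTransform weight = fun u => Complex.reCLM (𝓕 (fun x => (weight x : ℂ)) u) := by
    ext u
    rw [fourier_eq_cosTransform integrable_weight weight_neg]
    simp
  rw [h2]
  exact Complex.reCLM.contDiff.comp h

lemma tendsto_cosTransform_partialWeight (u : ℝ) :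
    Tendsto (fun n => cosTransform (partialWeight n) u) atTop (𝓝 (cosTransform weight u)) := by
  refine tendsto_integral_of_dominated_convergence fejer
    (fun n => (integrable_mul_cos (integrable_partialWeight n) _).aestronglyMeasurable)
    integrable_fejer (fun n => ae_of_all _ fun x => ?_)
    (ae_of_all _ fun x => (tendsto_partialWeight x).mul_const _)
  rw [norm_mul, norm_of_nonneg (partialWeight_nonneg n x)]
  exact (mul_le_of_le_one_right (partialWeight_nonneg n x) (abs_cos_le_one _)).trans
    (partialWeight_le_fejer n x)

lemma isUnimodal_cosTransform_weight : IsUnimodal (cosTransform weight) 1 where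
  continuous := contDiff_cosTransform_weight.continuous
  even := cosTransform_neg weight
  eq_zero u hu := tendsto_nhds_unique (tendsto_cosTransform_partialWeight u) <| by
    simp [fun n => (isUnimodal_one n).eq_zero u hu]
  antitone u v hu huv := le_of_tendsto_of_tendsto' (tendsto_cosTransform_partialWeight v)
    (tendsto_cosTransform_partialWeight u) fun n => (isUnimodal_one n).antitone u v hu huv

lemma cosTransform_cosTransform_weight (x : ℝ) :
    cosTransform (cosTransform weight) x = weight x := by
  have h1 : ∀ n, cosTransform (cosTransform (partialWeight n)) x = partialWeight n x := fun n =>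
    cosTransform_cosTransform (continuous_partialWeight n) (integrable_partialWeight n)
      (partialWeight_neg n) (isUnimodal_one n).integrable x
  have h2 : Tendsto (fun n => cosTransform (cosTransform (partialWeight n)) x) atTop
      (𝓝 (cosTransform (cosTransform weight) x)) := by
    refine tendsto_integral_of_dominated_convergence
      ((Icc (-1 : ℝ) 1).indicator fun _ => ∫ y, fejer y)
      (fun n => (integrable_mul_cos (isUnimodal_one n).integrable _).aestronglyMeasurable)
      ((integrable_indicator_iff measurableSet_Icc).2 (by simp))
      (fun n => ae_of_all _ fun u => ?_)
      (ae_of_all _ fun u => (tendsto_cosTransform_partialWeight u).mul_const _)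
    by_cases hu : u ∈ Icc (-1 : ℝ) 1
    · rw [indicator_of_mem hu, norm_mul]
      refine (mul_le_of_le_one_right (norm_nonneg _) (abs_cos_le_one _)).trans ?_
      refine norm_integral_le_of_norm_le integrable_fejer (ae_of_all _ fun y => ?_)
      rw [norm_mul, norm_of_nonneg (partialWeight_nonneg n y)]
      exact (mul_le_of_le_one_right (partialWeight_nonneg n y) (abs_cos_le_one _)).trans
        (partialWeight_le_fejer n y)
    · have : 1 ≤ |u| := by
        by_contra! h
        exact hu (abs_le.1 h.le)
      rw [(isUnimodal_one n).eq_zero_of_le_abs this, indicator_of_notMem hu]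
      simp
  simp only [h1] at h2
  exact tendsto_nhds_unique h2 (tendsto_partialWeight x)

/-- The unnormalized weight as a Schwartz function. -/
noncomputable def weightSchwartz : SchwartzMap ℝ ℝ :=
  SchwartzMap.postcompCLM (𝕜 := ℝ) Complex.reCLM <| 𝓕 <|
    HasCompactSupport.toSchwartzMap (f := fun u => (cosTransform weight u : ℂ))
      (isUnimodal_cosTransform_weight.hasCompactSupport.comp_left Complex.ofReal_zero)
      (Complex.ofRealCLM.contDiff.comp contDiff_cosTransform_weight)

lemma weightSchwartz_apply (x : ℝ) : weightSchwartz x = weight x := by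
  rw [weightSchwartz, SchwartzMap.postcompCLM_apply, SchwartzMap.fourier_coe]
  change Complex.reCLM (𝓕 (fun u => (cosTransform weight u : ℂ)) x) = _
  rw [fourier_eq_cosTransform isUnimodal_cosTransform_weight.integrable
    (cosTransform_neg weight), cosTransform_cosTransform_weight]
  simp

lemma integral_weight_pos : 0 < ∫ x, weight x := by
  have hc : Continuous weight := by
    simpa [← funext weightSchwartz_apply] using weightSchwartz.continuous
  exact integral_pos_of_integrable_nonneg_nonzero hc integrable_weight weight_nonneg (x := 0)
    (by rw [weight_zero]; norm_num)

/-- The entire extension of the unnormalized weight. -/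
noncomputable def entireWeight (z : ℂ) : ℂ :=
  ∫ u : ℝ, (cosTransform weight u : ℂ) * Complex.exp (-(2 * π * z * u) * Complex.I)

lemma entireWeight_ofReal (x : ℝ) : entireWeight x = weight x := by
  rw [← cosTransform_cosTransform_weight, ← integral_mul_cexp
    isUnimodal_cosTransform_weight.integrable (cosTransform_neg weight)]
  rfl

lemma differentiable_entireWeight : Differentiable ℂ entireWeight := by
  intro z₀
  have hG := isUnimodal_cosTransform_weight
  have hGc := hG.continuous
  have hderiv : ∀ (u : ℝ) (z : ℂ), HasDerivAt
      (fun z : ℂ => (cosTransform weight u : ℂ) * Complex.exp (-(2 * π * z * u) * Complex.I))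
      ((cosTransform weight u : ℂ) * (Complex.exp (-(2 * π * z * u) * Complex.I)
        * (-(2 * π * u) * Complex.I))) z := by
    intro u z
    refine HasDerivAt.const_mul _ (HasDerivAt.cexp ?_)
    refine (((hasDerivAt_id' z).const_mul (2 * π * u * Complex.I)).neg.congr_deriv
      ?_).congr_of_eventuallyEq (Eventually.of_forall fun w => ?_)
    · ring
    · simp only [Pi.neg_apply]; ring
  refine (hasDerivAt_integral_of_dominated_loc_of_deriv_le
    (bound := fun u => |cosTransform weight u| * (exp (2 * π * (‖z₀‖ + 1)) * (2 * π)))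
    (Metric.ball_mem_nhds z₀ one_pos) (Eventually.of_forall fun z => ?_) ?_ ?_
    (ae_of_all _ fun u z hz => ?_) ?_ (ae_of_all _ fun u z _ => hderiv u z)).2.differentiableAt
  · exact Continuous.aestronglyMeasurable (by fun_prop)
  · refine Continuous.integrable_of_hasCompactSupport (by fun_prop) ?_
    exact (hG.hasCompactSupport.comp_left (g := fun r : ℝ => (r : ℂ)) Complex.ofReal_zero).mul_right
  · exact Continuous.aestronglyMeasurable (by fun_prop)
  · rw [norm_mul, norm_mul, Complex.norm_real, norm_eq_abs]
    rcases le_or_gt 1 |u| with hu | hu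
    · rw [hG.eq_zero_of_le_abs hu]; simp
    · have hz' : ‖z‖ ≤ ‖z₀‖ + 1 := by
        have := norm_le_norm_add_norm_sub' z z₀
        rw [Metric.mem_ball, dist_eq_norm] at hz
        linarith
      refine mul_le_mul_of_nonneg_left (mul_le_mul ?_ ?_ (norm_nonneg _) (exp_pos _).le)
        (abs_nonneg _)
      · refine (Complex.norm_exp_le_exp_norm _).trans (exp_le_exp.2 ?_)
        simp only [norm_mul, norm_neg, Complex.norm_I, Complex.norm_real, norm_eq_abs,
          Complex.norm_ofNat, abs_of_pos pi_pos, mul_one]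
        rw [mul_assoc]
        refine mul_le_mul_of_nonneg_left ?_ (by positivity)
        nlinarith [norm_nonneg z, abs_nonneg u]
      · simp only [norm_mul, norm_neg, Complex.norm_I, Complex.norm_real, norm_eq_abs,
          Complex.norm_ofNat, abs_of_pos pi_pos, mul_one]
        exact mul_le_of_le_one_right (by positivity) hu.le
  · exact hG.integrable.abs.mul_const _

lemma weight_le_exp {x : ℝ} {n : ℕ}
    (h : ∀ k < n, 1 ≤ width k * |x|) : weight x ≤ exp (-(2 * n)) := by
  refine (weight_le n x).trans ?_
  have h1 : fejer x ≤ 1 := by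
    have := (sq_le_one_iff_abs_le_one _).2 (abs_sinc_le_one (π * x / 2))
    unfold fejer
    linarith
  have h2 : exp (-(2 * n)) = ∏ k ∈ Finset.range n, exp (-2) := by
    rw [Finset.prod_const, Finset.card_range, ← exp_nat_mul]
    ring_nf
  rw [h2]
  refine (mul_le_of_le_one_left (Finset.prod_nonneg fun _ _ => sq_nonneg _) h1).trans ?_
  refine Finset.prod_le_prod (fun k _ => sq_nonneg _) fun k hk => ?_
  have h3 := h k (Finset.mem_range.1 hk)
  have h4 : exp 1 ≤ |2 * π * width k * x| := by
    rw [abs_mul, abs_of_pos (by have := width_pos k; positivity)]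
    nlinarith [exp_one_lt_d9, pi_gt_three]
  refine (sinc_sq_le (abs_pos.1 ((exp_pos 1).trans_le h4))).trans ?_
  rw [← sq_abs, exp_neg, ← one_div]
  have h5 : exp 2 = exp 1 ^ 2 := by rw [← exp_nat_mul]; norm_num
  rw [h5]
  gcongr

lemma exists_large_bound : ∃ X : ℝ, ∀ x, X ≤ x → 1 ≤ x ∧ 66 * log (2 + x) ^ 2 ≤ x / 2 := by
  have h1 := (isLittleO_pow_log_id_atTop (n := 2)).bound (c := 1 / 264) (by norm_num)
  have h2 := (tendsto_atTop_add_const_left atTop (2 : ℝ) tendsto_id).eventually h1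
  obtain ⟨X, hX⟩ := eventually_atTop.1 (h2.and (eventually_ge_atTop (2 : ℝ)))
  refine ⟨X, fun x hx => ?_⟩
  obtain ⟨h3, h4⟩ := hX x hx
  simp only [id_eq, norm_eq_abs] at h3
  rw [abs_of_nonneg (sq_nonneg _), abs_of_nonneg (by linarith)] at h3
  constructor <;> linarith

lemma exists_weight_le : ∃ C : ℝ, 0 < C ∧
    ∀ x : ℝ, weight x ≤ C * exp (-|x| / log (2 + |x|) ^ 2) := by
  obtain ⟨X, hX⟩ := exists_large_bound
  refine ⟨exp (|X| / log 2 ^ 2), exp_pos _, fun x => ?_⟩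
  have hlog2 : 0 < log 2 := log_pos one_lt_two
  have hL2 : log 2 ≤ log (2 + |x|) := log_le_log (by norm_num) (by simp)
  rcases lt_or_ge |x| X with hx | hx
  · have h0 : weight x ≤ 1 := by simpa using weight_le_exp (x := x) (n := 0) (by simp)
    rw [← exp_add]
    refine h0.trans (one_le_exp ?_)
    have : |x| / log (2 + |x|) ^ 2 ≤ |X| / log 2 ^ 2 := by
      refine div_le_div₀ (abs_nonneg X) (hx.le.trans (le_abs_self X)) (by positivity) ?_
      gcongr
    rw [neg_div]
    linarith
  · obtain ⟨h1, h2⟩ := hX _ hx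
    set L := log (2 + |x|) with hL
    have hL1 : 1 ≤ L := by
      rw [hL, le_log_iff_exp_le (by positivity)]
      linarith [exp_one_lt_d9]
    have hC : 1 ≤ exp (|X| / log 2 ^ 2) := one_le_exp (by positivity)
    set n := ⌈|x| / (2 * L ^ 2)⌉₊ with hn
    have hn1 : |x| / (2 * L ^ 2) ≤ n := Nat.le_ceil _
    have hn2 : (n : ℝ) < |x| / (2 * L ^ 2) + 1 := Nat.ceil_lt_add_one (by positivity)
    have hkey : ∀ k < n, 1 ≤ width k * |x| := by
      intro k hk
      have hk' : (k : ℝ) + 65 ≤ |x| / (2 * L ^ 2) + 65 := by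
        have : (k : ℝ) + 1 ≤ n := by exact_mod_cast hk
        linarith
      have h3 : ((k : ℝ) + 65) * L ^ 2 ≤ |x| := by
        have h4 : (|x| / (2 * L ^ 2) + 66) * L ^ 2 = |x| / 2 + 66 * L ^ 2 := by
          field_simp
        have h5 : ((k : ℝ) + 65) * L ^ 2 ≤ (|x| / (2 * L ^ 2) + 66) * L ^ 2 := by
          exact mul_le_mul_of_nonneg_right (by linarith) (sq_nonneg L)
        linarith
      have h6 : (k : ℝ) + 65 ≤ |x| :=
        (le_mul_of_one_le_right (by positivity) (one_le_pow₀ hL1)).trans h3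
      have h7 : log (k + 65) ≤ L := log_le_log (by positivity) (by linarith)
      have h8 : 0 < log (k + 65) := log_pos (by linarith [(Nat.cast_nonneg k : (0 : ℝ) ≤ k)])
      calc 1 ≤ 1 / ((k + 65) * log (k + 65) ^ 2) * |x| := by
            rw [one_div_mul_eq_div, one_le_div (by positivity)]
            refine le_trans ?_ h3
            gcongr
        _ ≤ width k * |x| := mul_le_mul_of_nonneg_right (one_div_le_width k) (abs_nonneg x)
    refine (weight_le_exp hkey).trans ?_
    refine le_trans ?_ (le_mul_of_one_le_left (exp_pos _).le hC)
    rw [exp_le_exp, neg_div, neg_le_neg_iff]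
    have h3 : |x| / L ^ 2 = 2 * (|x| / (2 * L ^ 2)) := by field_simp
    linarith

end Ingham

/-- Ingham's theorem: there exists an entire function whose restriction to `ℝ` is a
real-valued, even, nonnegative Schwartz function `Ws`, whose Fourier transform
`Ŵ(u) = ∫ W(x) e^{-2πiux} dx` satisfies `Ŵ(0) = 1`, is supported in `[-1,1]`,
is weakly decreasing on `[0,1]`, and such that
`W(x) ≤ C exp(-|x| / log²(2 + |x|))` on the reals. -/
theorem exists_ingham_weight :
    ∃ (W : ℂ → ℂ) (Ws : SchwartzMap ℝ ℝ),
      Differentiable ℂ W ∧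
      (∀ x : ℝ, W x = (Ws x : ℂ)) ∧
      (∀ x : ℝ, Ws (-x) = Ws x) ∧
      (∀ x : ℝ, 0 ≤ Ws x) ∧
      (∫ x : ℝ, Ws x = 1) ∧
      (∀ u : ℝ, 1 < |u| →
        (∫ x : ℝ, (Ws x : ℂ) * Complex.exp (-(2 * Real.pi * u * x) * Complex.I)) = 0) ∧
      (∀ u v : ℝ, 0 ≤ u → u ≤ v → v ≤ 1 →
        (∫ x : ℝ, (Ws x : ℂ) * Complex.exp (-(2 * Real.pi * v * x) * Complex.I)).re ≤
        (∫ x : ℝ, (Ws x : ℂ) * Complex.exp (-(2 * Real.pi * u * x) * Complex.I)).re) ∧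
      (∃ C : ℝ, 0 < C ∧
        ∀ x : ℝ, Ws x ≤ C * Real.exp (-|x| / (Real.log (2 + |x|)) ^ 2)) := by
  have hI : 0 < ∫ x, Ingham.weight x := Ingham.integral_weight_pos
  set c : ℝ := (∫ x, Ingham.weight x)⁻¹ with hc
  have hcpos : 0 < c := inv_pos.2 hI
  have hval : ∀ x, (c • Ingham.weightSchwartz) x = c * Ingham.weight x := fun x => by
    simp [Ingham.weightSchwartz_apply]
  have hG := Ingham.isUnimodal_cosTransform_weight
  have hF : ∀ u : ℝ, (∫ x : ℝ, ((c • Ingham.weightSchwartz) x : ℂ)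
      * Complex.exp (-(2 * Real.pi * u * x) * Complex.I))
      = ((c * Ingham.cosTransform Ingham.weight u : ℝ) : ℂ) := fun u => by
    simp only [hval, Complex.ofReal_mul, mul_assoc (c : ℂ)]
    rw [integral_const_mul, ← Ingham.integral_mul_cexp Ingham.integrable_weight Ingham.weight_neg]
  refine ⟨fun z => c * Ingham.entireWeight z, c • Ingham.weightSchwartz,
    Ingham.differentiable_entireWeight.const_mul _, fun x => ?_, fun x => ?_, fun x => ?_, ?_,
    fun u hu => ?_, fun u v hu huv _ => ?_, ?_⟩
  · beta_reduce
    rw [hval, Ingham.entireWeight_ofReal, Complex.ofReal_mul]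
  · rw [hval, hval, Ingham.weight_neg]
  · rw [hval]
    exact mul_nonneg hcpos.le (Ingham.weight_nonneg x)
  · simp only [hval]
    rw [integral_const_mul, hc, inv_mul_cancel₀ hI.ne']
  · rw [hF, hG.eq_zero_of_le_abs hu.le]
    simp
  · rw [hF, hF, Complex.ofReal_re, Complex.ofReal_re]
    exact mul_le_mul_of_nonneg_left (hG.antitone u v hu huv) hcpos.le
  · obtain ⟨C, hC, hle⟩ := Ingham.exists_weight_le
    refine ⟨c * C, mul_pos hcpos hC, fun x => ?_⟩
    rw [hval, mul_assoc]
    exact mul_le_mul_of_nonneg_left (hle x) hcpos.le
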